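/- Assume σ satisfies condition (4.1): T_{deg(a)⁻¹}(T_{deg(c)⁻¹}(σ^{bd}_{ac})) = T_{deg(b)⁻¹}(T_{deg(d)⁻¹}(σ^{bd}_{ac})) for all a,b,c,d ∈ X, and assume σ satisfies conditions (1)–(5). Then in A_σ, for all a,b ∈ X: Σ_{c,d∈X} (Q_{ac} ⊗ Q⁻¹_{db})L_{cd} + I_σ = Σ_{c,d∈X} (Q''⁻¹_{ac} ⊗ Q''_{db})L_{cd} + I_σ, and Σ_{c,d∈X} (Q'⁻¹_{db} ⊗ Q'_{ac})(L⁻¹)_{cd} + I_σ = Σ_{c,d∈X} (Q'''_{bd} ⊗ Q'''⁻¹_{ca})(L⁻¹)_{cd} + I_σ. -/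

import Mathlib

open scoped TensorProduct
open MulOpposite

noncomputable section

set_option linter.unusedSectionVars false

variable (k L X G : Type*) [CommRing k] [Ring L] [Algebra k L] [Fintype X]
  [DecidableEq X] [Group G]

/-- The set `Gen` of generators: the underlying set of `L ⊗[k] Lᵐᵒᵖ` together with two
families of formal symbols `L_{ab}` and `(L⁻¹)_{ab}` indexed by `X × X`. -/
abbrev Gen : Type _ := (L ⊗[k] Lᵐᵒᵖ) ⊕ (X × X) ⊕ (X × X)

/-- The generator of `k⟨Gen⟩` corresponding to `ξ ∈ L ⊗[k] Lᵐᵒᵖ`. -/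
def iT (ξ : L ⊗[k] Lᵐᵒᵖ) : FreeAlgebra k (Gen k L X) := FreeAlgebra.ι k (Sum.inl ξ)

/-- The generator `L_{ab}` of `k⟨Gen⟩`. -/
def iL (a b : X) : FreeAlgebra k (Gen k L X) := FreeAlgebra.ι k (Sum.inr (Sum.inl (a, b)))

/-- The generator `(L⁻¹)_{ab}` of `k⟨Gen⟩`. -/
def iLi (a b : X) : FreeAlgebra k (Gen k L X) := FreeAlgebra.ι k (Sum.inr (Sum.inr (a, b)))

/-- `f ⊗ 1_L ∈ L ⊗[k] Lᵐᵒᵖ`. -/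
def sE (f : L) : L ⊗[k] Lᵐᵒᵖ := f ⊗ₜ[k] (1 : Lᵐᵒᵖ)

/-- `1_L ⊗ f ∈ L ⊗[k] Lᵐᵒᵖ`. -/
def tE (f : L) : L ⊗[k] Lᵐᵒᵖ := (1 : L) ⊗ₜ[k] (op f)

variable (deg : X → G) (T : G → L ≃ₐ[k] L) (σ : X → X → X → X → L)

/-- The set of generators (i)–(v) of the two-sided ideal `I_σ`. -/
def relSet : Set (FreeAlgebra k (Gen k L X)) :=
  {w | (∃ ξ ξ' : L ⊗[k] Lᵐᵒᵖ, w = iT k L X ξ + iT k L X ξ' - iT k L X (ξ + ξ')) ∨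
    (∃ (c : k) (ξ : L ⊗[k] Lᵐᵒᵖ), w = c • iT k L X ξ - iT k L X (c • ξ)) ∨
    (∃ ξ ξ' : L ⊗[k] Lᵐᵒᵖ, w = iT k L X ξ * iT k L X ξ' - iT k L X (ξ * ξ')) ∨
    (∃ a b : X, w = (∑ c : X, iL k L X a c * iLi k L X c b) - if a = b then 1 else 0) ∨
    (∃ a b : X, w = (∑ c : X, iLi k L X a c * iL k L X c b) - if a = b then 1 else 0) ∨
    (∃ (f : L) (a b : X),
      w = iT k L X (sE k L (T (deg a) f)) * iL k L X a b - iL k L X a b * iT k L X (sE k L f)) ∨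
    (∃ (f : L) (a b : X),
      w = iT k L X (tE k L (T (deg b) f)) * iL k L X a b - iL k L X a b * iT k L X (tE k L f)) ∨
    (∃ (f : L) (a b : X),
      w = iT k L X (sE k L f) * iLi k L X a b - iLi k L X a b * iT k L X (sE k L (T (deg b) f))) ∨
    (∃ (f : L) (a b : X),
      w = iT k L X (tE k L f) * iLi k L X a b - iLi k L X a b * iT k L X (tE k L (T (deg a) f))) ∨
    (∃ a b c d : X,
      w = (∑ x : X, ∑ y : X, iT k L X (sE k L (σ x y a c)) * iL k L X y d * iL k L X x b) -
        ∑ x : X, ∑ y : X, iT k L X (tE k L (σ b d x y)) * iL k L X c y * iL k L X a x) ∨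
    w = 1 - iT k L X (1 : L ⊗[k] Lᵐᵒᵖ)}

/-- The two-sided ideal `I_σ` of `k⟨Gen⟩`. -/
def Isig : TwoSidedIdeal (FreeAlgebra k (Gen k L X)) :=
  TwoSidedIdeal.span (relSet k L X G deg T σ)

/-- The quotient algebra `A_σ = k⟨Gen⟩ / I_σ`. -/
def Asig : Type _ := (Isig k L X G deg T σ).ringCon.Quotient

instance : Ring (Asig k L X G deg T σ) :=
  inferInstanceAs (Ring (RingCon.Quotient _))

/-- The quotient map `k⟨Gen⟩ → A_σ`, `w ↦ w + I_σ`. -/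
def mkA : FreeAlgebra k (Gen k L X) →+* Asig k L X G deg T σ := RingCon.mk' _

instance : Algebra k (Asig k L X G deg T σ) :=
  RingHom.toAlgebra' ((mkA k L X G deg T σ).comp (algebraMap k (FreeAlgebra k (Gen k L X))))
    (by
      intro c x
      obtain ⟨y, rfl⟩ := Quotient.mk''_surjective (α := FreeAlgebra k (Gen k L X)) x
      show mkA k L X G deg T σ _ * mkA k L X G deg T σ y =
        mkA k L X G deg T σ y * mkA k L X G deg T σ _
      rw [← map_mul, ← map_mul, Algebra.commutes])

section AbstractRelations

open Finset

variable {L X G A : Type*} [Ring L] [Ring A] [Fintype X] [DecidableEq X]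
  {s : L →+* A} {t : Lᵐᵒᵖ →+* A} {M N : X → X → A}

theorem sum_sum_comm_sum_sum {X A : Type*} [AddCommMonoid A] [Fintype X]
    (F : X → X → X → X → A) :
    ∑ a, ∑ b, ∑ c, ∑ d, F a b c d = ∑ c, ∑ d, ∑ a, ∑ b, F a b c d := by
  have h : ∀ H : X → X → X → A, ∑ a, ∑ b, ∑ c, H a b c = ∑ c, ∑ a, ∑ b, H a b c :=
    fun H => (sum_congr rfl fun _ _ => sum_comm).trans sum_comm
  rw [h]
  exact sum_congr rfl fun c _ => h _

/-- Multiplying the `RLL` relation by the inverse `N` of `M` on both sides. -/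
theorem exchange_of_rll {S : X → L → L} {σ : X → X → X → X → L}
    (hMN : ∀ a b, ∑ c, M a c * N c b = if a = b then 1 else 0)
    (hNM : ∀ a b, ∑ c, N a c * M c b = if a = b then 1 else 0)
    (hNs : ∀ f a b, N a b * s f = s (S b f) * N a b)
    (hNt : ∀ f a b, N a b * t (op f) = t (op (S a f)) * N a b)
    (hrll : ∀ a b c d, ∑ x, ∑ y, s (σ x y a c) * M y d * M x b =
      ∑ x, ∑ y, t (op (σ b d x y)) * M c y * M a x) (a d e f : X) :
    ∑ c, ∑ y, s (S c (σ f y a c)) * (N e c * M y d) =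
      ∑ x, ∑ b, t (op (S e (σ b d x e))) * (M a x * N b f) := by
  have hright : ∀ c, ∑ y, s (σ f y a c) * M y d =
      ∑ b, ∑ x, ∑ y, t (op (σ b d x y)) * M c y * M a x * N b f := by
    intro c
    calc ∑ y, s (σ f y a c) * M y d
        = ∑ x, ∑ y, s (σ x y a c) * M y d * (∑ b, M x b * N b f) := by
          rw [sum_comm]
          simp [hMN]
      _ = ∑ b, (∑ x, ∑ y, s (σ x y a c) * M y d * M x b) * N b f := by
          simp only [mul_sum, sum_mul, mul_assoc]
          rw [sum_comm]
          conv_rhs => rw [sum_comm]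
          rw [sum_comm]
          exact sum_congr rfl fun x _ => sum_comm
      _ = _ := by simp only [hrll, sum_mul]
  calc ∑ c, ∑ y, s (S c (σ f y a c)) * (N e c * M y d)
      = ∑ c, N e c * ∑ y, s (σ f y a c) * M y d := by
        simp only [mul_sum, ← mul_assoc, hNs]
    _ = ∑ c, ∑ b, ∑ x, ∑ y, t (op (S e (σ b d x y))) * (N e c * M c y) * (M a x * N b f) := by
        simp only [hright, mul_sum, ← mul_assoc, hNt]
    _ = ∑ b, ∑ x, ∑ y, ∑ c, t (op (S e (σ b d x y))) * (N e c * M c y) * (M a x * N b f) := by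
        rw [sum_comm]
        refine sum_congr rfl fun b _ => ?_
        rw [sum_comm]
        exact sum_congr rfl fun x _ => sum_comm
    _ = ∑ b, ∑ x, t (op (S e (σ b d x e))) * (M a x * N b f) := by
        simp only [← sum_mul, ← mul_sum, hNM]
        simp
    _ = _ := sum_comm

/-- Moving the coefficients of an exchange relation to the other side by means of an inverse
of the coefficient family. -/
theorem exchange_inv {τ i : X → X → X → X → L}
    (hcomm : ∀ f g, s f * t (op g) = t (op g) * s f)
    (hiτ : ∀ w x y z, ∑ a, ∑ b, i w a z b * τ b y a x = if w = x ∧ y = z then 1 else 0)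
    (hτi : ∀ w x y z, ∑ a, ∑ b, τ w a z b * i b y a x = if w = x ∧ y = z then 1 else 0)
    (hex : ∀ a d e f, ∑ c, ∑ y, s (τ f y a c) * (N e c * M y d) =
      ∑ x, ∑ b, t (op (τ b d x e)) * (M a x * N b f)) (p q w z : X) :
    ∑ d, ∑ e, t (op (i e p d q)) * (N e w * M z d) =
      ∑ a, ∑ f, s (i w a z f) * (M a p * N q f) := by
  have hleft : ∀ d e, N e w * M z d =
      ∑ a, ∑ f, ∑ x, ∑ b, s (i w a z f) * (t (op (τ b d x e)) * (M a x * N b f)) := by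
    intro d e
    calc N e w * M z d
        = ∑ c, ∑ y, s (∑ a, ∑ f, i w a z f * τ f y a c) * (N e c * M y d) := by
          simp [hiτ, ite_and, apply_ite s]
      _ = ∑ c, ∑ y, ∑ a, ∑ f, s (i w a z f) * (s (τ f y a c) * (N e c * M y d)) := by
          simp only [map_sum, map_mul, sum_mul, mul_assoc]
      _ = ∑ a, ∑ f, ∑ c, ∑ y, s (i w a z f) * (s (τ f y a c) * (N e c * M y d)) := by
          exact sum_sum_comm_sum_sum _
      _ = _ := by simp only [← mul_sum, hex]
  calc ∑ d, ∑ e, t (op (i e p d q)) * (N e w * M z d)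
      = ∑ d, ∑ e, ∑ a, ∑ f, ∑ x, ∑ b, s (i w a z f) *
          (t (op (τ b d x e * i e p d q)) * (M a x * N b f)) := by
        have hmove : ∀ f g h z, t (op f) * (s g * (t (op h) * z)) =
            s g * (t (op (h * f)) * z) := by
          intro f g h z
          rw [← mul_assoc, ← hcomm, op_mul, map_mul]
          simp only [mul_assoc]
        simp only [hleft, mul_sum, hmove]
    _ = ∑ a, ∑ f, ∑ x, ∑ b, ∑ d, ∑ e, s (i w a z f) *
          (t (op (τ b d x e * i e p d q)) * (M a x * N b f)) := by
        rw [sum_sum_comm_sum_sum]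
        exact sum_congr rfl fun a _ => sum_congr rfl fun f _ => sum_sum_comm_sum_sum _
    _ = ∑ a, ∑ f, ∑ x, ∑ b, s (i w a z f) *
          (t (op (∑ d, ∑ e, τ b d x e * i e p d q)) * (M a x * N b f)) := by
        simp only [op_sum, map_sum, mul_sum, sum_mul]
    _ = _ := by
        simp [hτi, ite_and, apply_ite op, apply_ite t]

/-- A left inverse and a right inverse of the transpose of a family agree. -/
theorem transpose_inverse_unique {x x' : X → X → A}
    (hx : ∀ q r, ∑ f, x f r * N q f = if q = r then 1 else 0)
    (hx' : ∀ f g, ∑ q, N q f * x' g q = if f = g then 1 else 0) (a b : X) :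
    x a b = x' a b := by
  calc x a b = ∑ f, x f b * ∑ q, N q f * x' a q := by simp [hx']
    _ = ∑ q, (∑ f, x f b * N q f) * x' a q := by
        simp only [mul_sum, sum_mul, mul_assoc]
        exact sum_comm
    _ = x' a b := by simp [hx]

/-- The contraction of the exchange relation over the indices of `N * M`. -/
theorem target_contraction {i : X → X → X → X → L} {Q : X → X → L}
    (hNM : ∀ a b, ∑ c, N a c * M c b = if a = b then 1 else 0)
    (hi : ∀ p q w z, ∑ d, ∑ e, t (op (i e p d q)) * (N e w * M z d) =
      ∑ a, ∑ f, s (i w a z f) * (M a p * N q f))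
    (hQ : ∀ a b, Q a b = ∑ u, i u b u a) (p q : X) :
    t (op (Q q p)) = ∑ a, ∑ f, s (Q f a) * (M a p * N q f) := by
  calc t (op (Q q p)) = ∑ d, ∑ e, t (op (i e p d q)) * ∑ w, N e w * M w d := by
        simp [hNM, hQ]
    _ = ∑ w, ∑ d, ∑ e, t (op (i e p d q)) * (N e w * M w d) := by
        simp only [mul_sum]
        conv_rhs => rw [sum_comm]
        exact sum_congr rfl fun d _ => sum_comm
    _ = ∑ w, ∑ a, ∑ f, s (i w a w f) * (M a p * N q f) := by simp only [hi]
    _ = _ := by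
        simp only [hQ, map_sum, sum_mul]
        rw [sum_comm]
        exact sum_congr rfl fun a _ => sum_comm

/-- The contraction of the exchange relation over the indices of `M * N`. -/
theorem source_contraction {i : X → X → X → X → L} {Q' : X → X → L}
    (hMN : ∀ a b, ∑ c, M a c * N c b = if a = b then 1 else 0)
    (hi : ∀ p q w z, ∑ d, ∑ e, t (op (i e p d q)) * (N e w * M z d) =
      ∑ a, ∑ f, s (i w a z f) * (M a p * N q f))
    (hQ' : ∀ a b, Q' a b = ∑ u, i b u a u) (w z : X) :
    s (Q' z w) = ∑ d, ∑ e, t (op (Q' d e)) * (N e w * M z d) := by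
  calc s (Q' z w) = ∑ a, ∑ f, s (i w a z f) * ∑ p, M a p * N p f := by
        simp [hMN, hQ']
    _ = ∑ p, ∑ a, ∑ f, s (i w a z f) * (M a p * N p f) := by
        simp only [mul_sum]
        conv_rhs => rw [sum_comm]
        exact sum_congr rfl fun a _ => sum_comm
    _ = ∑ p, ∑ d, ∑ e, t (op (i e p d p)) * (N e w * M z d) := by simp only [hi]
    _ = _ := by
        simp only [hQ', op_sum, map_sum, sum_mul]
        rw [sum_comm]
        exact sum_congr rfl fun a _ => sum_comm

/-- The two formulas for the transposed inverse of `N` agree. -/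
theorem transpose_inverse_right_formulas {S T : X → L →+* L} {Q Qinv Q' Q'' Q''inv : X → X → L}
    (hcomm : ∀ f g, s f * t (op g) = t (op g) * s f)
    (hNs : ∀ f a b, N a b * s f = s (S b f) * N a b)
    (hNt : ∀ f a b, N a b * t (op f) = t (op (S a f)) * N a b)
    (hST : ∀ a f, S a (T a f) = f)
    (hQt : ∀ p q, t (op (Q q p)) = ∑ a, ∑ f, s (Q f a) * (M a p * N q f))
    (hQs : ∀ w z, s (Q' z w) = ∑ d, ∑ e, t (op (Q' d e)) * (N e w * M z d))
    (hQinv : ∀ a c, ∑ b, Q a b * Qinv b c = if a = c then 1 else 0)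
    (hQ'' : ∀ a b, Q'' a b = T b (Q' a b))
    (hQ''inv : ∀ a c, ∑ b, Q''inv a b * Q'' b c = if a = c then 1 else 0) (a b : X) :
    ∑ c, ∑ d, s (Q a c) * t (op (Qinv d b)) * M c d =
      ∑ c, ∑ d, s (Q''inv a c) * t (op (Q'' d b)) * M c d := by
  refine transpose_inverse_unique (N := N)
    (x := fun a b => ∑ c, ∑ d, s (Q a c) * t (op (Qinv d b)) * M c d)
    (x' := fun a b => ∑ c, ∑ d, s (Q''inv a c) * t (op (Q'' d b)) * M c d) ?_ ?_ a b
  · intro q r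
    calc ∑ f, (∑ c, ∑ d, s (Q f c) * t (op (Qinv d r)) * M c d) * N q f
        = ∑ f, ∑ c, ∑ d, t (op (Qinv d r)) * (s (Q f c) * (M c d * N q f)) := by
          simp only [sum_mul, hcomm, mul_assoc]
      _ = ∑ d, t (op (Qinv d r)) * ∑ c, ∑ f, s (Q f c) * (M c d * N q f) := by
          simp only [mul_sum]
          rw [sum_comm]
          conv_rhs => rw [sum_comm]
          exact sum_congr rfl fun c _ => sum_comm
      _ = t (op (∑ d, Q q d * Qinv d r)) := by
          simp only [← hQt, ← map_mul, ← op_mul, op_sum, map_sum]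
      _ = _ := by simp [hQinv, apply_ite op, apply_ite t]
  · intro f g
    calc ∑ q, N q f * ∑ c, ∑ d, s (Q''inv g c) * t (op (Q'' d q)) * M c d
        = ∑ q, ∑ c, ∑ d, s (S f (Q''inv g c)) * (t (op (Q' d q)) * (N q f * M c d)) := by
          refine sum_congr rfl fun q _ => ?_
          simp only [mul_sum]
          refine sum_congr rfl fun c _ => sum_congr rfl fun d _ => ?_
          rw [← mul_assoc, ← mul_assoc, hNs, mul_assoc (s _), hNt, hQ'', hST]
          simp only [mul_assoc]
      _ = ∑ c, s (S f (Q''inv g c)) * ∑ d, ∑ q, t (op (Q' d q)) * (N q f * M c d) := by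
          simp only [mul_sum]
          rw [sum_comm]
          exact sum_congr rfl fun c _ => sum_comm
      _ = s (S f (∑ c, Q''inv g c * Q'' c f)) := by
          simp only [← hQs, hQ'', map_sum, map_mul, hST]
      _ = _ := by simp [hQ''inv, apply_ite (S f), apply_ite s, eq_comm]

/-- The two formulas for the transposed inverse of `M` agree. -/
theorem transpose_inverse_left_formulas {S T : X → L →+* L}
    {Q Q' Q'inv Q''' Q'''inv : X → X → L}
    (hcomm : ∀ f g, s f * t (op g) = t (op g) * s f)
    (hMs : ∀ f a b, M a b * s f = s (T a f) * M a b)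
    (hMt : ∀ f a b, M a b * t (op f) = t (op (T b f)) * M a b)
    (hTS : ∀ a f, T a (S a f) = f)
    (hQt : ∀ p q, t (op (Q q p)) = ∑ a, ∑ f, s (Q f a) * (M a p * N q f))
    (hQs : ∀ w z, s (Q' z w) = ∑ d, ∑ e, t (op (Q' d e)) * (N e w * M z d))
    (hQ'inv : ∀ a c, ∑ b, Q'inv b c * Q' a b = if a = c then 1 else 0)
    (hQ''' : ∀ a b, Q''' a b = S a (Q b a))
    (hQ'''inv : ∀ a c, ∑ b, Q''' a b * Q'''inv b c = if a = c then 1 else 0) (a b : X) :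
    ∑ c, ∑ d, s (Q'inv d b) * t (op (Q' a c)) * N c d =
      ∑ c, ∑ d, s (Q''' b d) * t (op (Q'''inv c a)) * N c d := by
  refine transpose_inverse_unique (N := M)
    (x := fun a b => ∑ c, ∑ d, s (Q'inv d b) * t (op (Q' a c)) * N c d)
    (x' := fun a b => ∑ c, ∑ d, s (Q''' b d) * t (op (Q'''inv c a)) * N c d) ?_ ?_ a b
  · intro z r
    calc ∑ f, (∑ c, ∑ d, s (Q'inv d r) * t (op (Q' f c)) * N c d) * M z f
        = ∑ f, ∑ c, ∑ d, s (Q'inv d r) * (t (op (Q' f c)) * (N c d * M z f)) := by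
          simp only [sum_mul, mul_assoc]
      _ = ∑ d, s (Q'inv d r) * ∑ f, ∑ c, t (op (Q' f c)) * (N c d * M z f) := by
          simp only [mul_sum]
          conv_rhs => rw [sum_comm]
          exact sum_congr rfl fun c _ => sum_comm
      _ = s (∑ d, Q'inv d r * Q' z d) := by
          simp only [← hQs, ← map_mul, map_sum]
      _ = _ := by simp [hQ'inv, apply_ite s]
  · intro d g
    calc ∑ z, M z d * ∑ c, ∑ e, s (Q''' z e) * t (op (Q'''inv c g)) * N c e
        = ∑ z, ∑ c, ∑ e, t (op (T d (Q'''inv c g))) * (s (Q e z) * (M z d * N c e)) := by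
          refine sum_congr rfl fun z _ => ?_
          simp only [mul_sum]
          refine sum_congr rfl fun c _ => sum_congr rfl fun e _ => ?_
          rw [hcomm, ← mul_assoc, ← mul_assoc, hMt, mul_assoc (t _), hMs, hQ''', hTS]
          simp only [mul_assoc]
      _ = ∑ c, t (op (T d (Q'''inv c g))) * ∑ z, ∑ e, s (Q e z) * (M z d * N c e) := by
          simp only [mul_sum]
          exact sum_comm
      _ = t (op (T d (∑ c, Q''' d c * Q'''inv c g))) := by
          simp only [← hQt, hQ''', map_sum, map_mul, hTS, op_sum, op_mul]
      _ = _ := by simp [hQ'''inv, apply_ite (T d), apply_ite op, apply_ite t]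

end AbstractRelations

section Quotient

theorem mkA_eq_of_sub_mem {w w' : FreeAlgebra k (Gen k L X)}
    (h : w - w' ∈ relSet k L X G deg T σ) :
    mkA k L X G deg T σ w = mkA k L X G deg T σ w' :=
  Quotient.sound (((Isig k L X G deg T σ).rel_iff w w').2 (TwoSidedIdeal.subset_span h))

/-- The algebra map `L ⊗ L^op → A_σ` as a ring homomorphism. -/
def tensorToA : L ⊗[k] Lᵐᵒᵖ →+* Asig k L X G deg T σ where
  toFun ξ := mkA k L X G deg T σ (iT k L X ξ)
  map_one' := by
    rw [← map_one (mkA k L X G deg T σ)]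
    exact (mkA_eq_of_sub_mem k L X G deg T σ (by simp [relSet])).symm
  map_mul' ξ ξ' := by
    rw [← map_mul]
    exact (mkA_eq_of_sub_mem k L X G deg T σ (Or.inr <| Or.inr <| Or.inl ⟨ξ, ξ', rfl⟩)).symm
  map_add' ξ ξ' := by
    rw [← map_add]
    exact (mkA_eq_of_sub_mem k L X G deg T σ (Or.inl ⟨ξ, ξ', rfl⟩)).symm
  map_zero' := by
    have h := mkA_eq_of_sub_mem k L X G deg T σ (w := iT k L X 0 + iT k L X 0)
      (w' := iT k L X (0 + 0)) (Or.inl ⟨0, 0, rfl⟩)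
    rw [map_add, add_zero] at h
    exact left_eq_add.1 h.symm

end Quotient

/-- Under conditions (1)–(5), the two formulas for `x_{ab}` agree in `A_σ`, and so do the
two formulas for `y_{ab}`. -/
theorem witness_formulas_agree (hT : ∀ (α : G) (f : L), T α (T α⁻¹ f) = f)
    (h41 : ∀ a b c d : X,
      T (deg a)⁻¹ (T (deg c)⁻¹ (σ b d a c)) = T (deg b)⁻¹ (T (deg d)⁻¹ (σ b d a c)))
    (isg : X → X → X → X → L)
    (h1a : ∀ w x' y z : X,
      (∑ a : X, ∑ b : X, isg w a z b * T (deg x')⁻¹ (σ b y a x')) =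
        if w = x' ∧ y = z then 1 else 0)
    (h1b : ∀ w x' y z : X,
      (∑ a : X, ∑ b : X, T (deg b)⁻¹ (σ w a z b) * isg b y a x') =
        if w = x' ∧ y = z then 1 else 0)
    (Q Qinv : X → X → L)
    (hQ : ∀ a b : X, Q a b = ∑ u : X, isg u b u a)
    (hQinv : ∀ a c : X, (∑ b : X, Q a b * Qinv b c) = if a = c then 1 else 0)
    (Q' Q'inv : X → X → L)
    (hQ' : ∀ a b : X, Q' a b = ∑ u : X, isg b u a u)
    (hQ'inv : ∀ a c : X, (∑ b : X, Q'inv b c * Q' a b) = if a = c then 1 else 0)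
    (Q'' Q''inv : X → X → L)
    (hQ'' : ∀ a b : X, Q'' a b = ∑ u : X, T (deg b) (isg b u a u))
    (hQ''inv : ∀ a c : X, (∑ b : X, Q''inv a b * Q'' b c) = if a = c then 1 else 0)
    (Q''' Q'''inv : X → X → L)
    (hQ''' : ∀ a b : X, Q''' a b = ∑ u : X, T (deg a)⁻¹ (isg u a u b))
    (hQ'''inv : ∀ a c : X, (∑ b : X, Q''' a b * Q'''inv b c) = if a = c then 1 else 0) :
    ∀ a b : X,
      mkA k L X G deg T σ (∑ c : X, ∑ d : X,
          iT k L X (Q a c ⊗ₜ[k] op (Qinv d b)) * iL k L X c d) =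
        mkA k L X G deg T σ (∑ c : X, ∑ d : X,
          iT k L X (Q''inv a c ⊗ₜ[k] op (Q'' d b)) * iL k L X c d) ∧
      mkA k L X G deg T σ (∑ c : X, ∑ d : X,
          iT k L X (Q'inv d b ⊗ₜ[k] op (Q' a c)) * iLi k L X c d) =
        mkA k L X G deg T σ (∑ c : X, ∑ d : X,
          iT k L X (Q''' b d ⊗ₜ[k] op (Q'''inv c a)) * iLi k L X c d) := by
  set π := mkA k L X G deg T σ with hπ
  set s : L →+* Asig k L X G deg T σ :=
    (tensorToA k L X G deg T σ).comp Algebra.TensorProduct.includeLeftRingHom with hs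
  set t : Lᵐᵒᵖ →+* Asig k L X G deg T σ := (tensorToA k L X G deg T σ).comp
    (Algebra.TensorProduct.includeRight : Lᵐᵒᵖ →ₐ[k] L ⊗[k] Lᵐᵒᵖ).toRingHom with ht
  set M : X → X → Asig k L X G deg T σ := fun a b => π (iL k L X a b) with hM
  set N : X → X → Asig k L X G deg T σ := fun a b => π (iLi k L X a b) with hN
  have hsE : ∀ f, π (iT k L X (sE k L f)) = s f := fun _ => rfl
  have htE : ∀ f, π (iT k L X (tE k L f)) = t (op f) := fun _ => rfl
  have hst : ∀ f g, π (iT k L X (f ⊗ₜ[k] op g)) = s f * t (op g) := by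
    intro f g
    have h : f ⊗ₜ[k] op g = (f ⊗ₜ[k] (1 : Lᵐᵒᵖ)) * ((1 : L) ⊗ₜ[k] op g) := by simp
    rw [h]
    exact map_mul (tensorToA k L X G deg T σ) _ _
  have hcomm : ∀ f g, s f * t (op g) = t (op g) * s f := by
    intro f g
    simp [hs, ht, ← map_mul]
  have hTinv : ∀ α f, T α⁻¹ (T α f) = f := by
    intro α f
    simpa using hT α⁻¹ f
  have hMN : ∀ a b, ∑ c, M a c * N c b = if a = b then 1 else 0 := by
    intro a b
    have h := mkA_eq_of_sub_mem k L X G deg T σ (w := ∑ c, iL k L X a c * iLi k L X c b)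
      (w' := if a = b then 1 else 0) (by simp only [relSet, Set.mem_ofPred_eq]; grind)
    simpa [apply_ite (mkA k L X G deg T σ)] using h
  have hNM : ∀ a b, ∑ c, N a c * M c b = if a = b then 1 else 0 := by
    intro a b
    have h := mkA_eq_of_sub_mem k L X G deg T σ (w := ∑ c, iLi k L X a c * iL k L X c b)
      (w' := if a = b then 1 else 0) (by simp only [relSet, Set.mem_ofPred_eq]; grind)
    simpa [apply_ite (mkA k L X G deg T σ)] using h
  have hMs : ∀ f a b, M a b * s f = s (T (deg a) f) * M a b := by
    intro f a b
    simp only [hM, ← hsE, hπ, ← map_mul]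
    exact (mkA_eq_of_sub_mem k L X G deg T σ (by
      iterate 5 right
      exact Or.inl ⟨f, a, b, rfl⟩)).symm
  have hMt : ∀ f a b, M a b * t (op f) = t (op (T (deg b) f)) * M a b := by
    intro f a b
    simp only [hM, ← htE, hπ, ← map_mul]
    exact (mkA_eq_of_sub_mem k L X G deg T σ (by
      iterate 6 right
      exact Or.inl ⟨f, a, b, rfl⟩)).symm
  have hNs : ∀ f a b, N a b * s f = s (T (deg b)⁻¹ f) * N a b := by
    intro f a b
    have h : s (T (deg b)⁻¹ f) * N a b = N a b * s (T (deg b) (T (deg b)⁻¹ f)) := by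
      simp only [hN, ← hsE, hπ, ← map_mul]
      exact mkA_eq_of_sub_mem k L X G deg T σ (by
        iterate 7 right
        exact Or.inl ⟨_, a, b, rfl⟩)
    rw [h, hT]
  have hNt : ∀ f a b, N a b * t (op f) = t (op (T (deg a)⁻¹ f)) * N a b := by
    intro f a b
    have h : t (op (T (deg a)⁻¹ f)) * N a b = N a b * t (op (T (deg a) (T (deg a)⁻¹ f))) := by
      simp only [hN, ← htE, hπ, ← map_mul]
      exact mkA_eq_of_sub_mem k L X G deg T σ (by
        iterate 8 right
        exact Or.inl ⟨_, a, b, rfl⟩)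
    rw [h, hT]
  have hrll : ∀ a b c d, ∑ x, ∑ y, s (σ x y a c) * M y d * M x b =
      ∑ x, ∑ y, t (op (σ b d x y)) * M c y * M a x := by
    intro a b c d
    simp only [hM, ← hsE, ← htE, hπ, ← map_mul, ← map_sum]
    exact mkA_eq_of_sub_mem k L X G deg T σ (by
      iterate 9 right
      exact Or.inl ⟨a, b, c, d, rfl⟩)
  have hi := exchange_inv hcomm h1a h1b
    (exchange_of_rll (S := fun a f => T (deg a)⁻¹ f) hMN hNM hNs hNt hrll)
  have hQt := target_contraction hNM hi hQ
  have hQs := source_contraction hMN hi hQ'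
  intro a b
  constructor
  · simp only [map_sum, map_mul, hst]
    exact transpose_inverse_right_formulas (S := fun a => (T (deg a)⁻¹ : L →+* L))
      (T := fun a => (T (deg a) : L →+* L)) hcomm hNs hNt (fun a => hTinv (deg a)) hQt hQs
      hQinv (by simp [hQ'', hQ']) hQ''inv a b
  · simp only [map_sum, map_mul, hst]
    exact transpose_inverse_left_formulas (S := fun a => (T (deg a)⁻¹ : L →+* L))
      (T := fun a => (T (deg a) : L →+* L)) hcomm hMs hMt (fun a => hT (deg a)) hQt hQs
      hQ'inv (by simp [hQ''', hQ]) hQ'''inv a b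

end
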